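/- arXiv:1612.03608 — 4 statements merged into one kernel-verified Lean document; each statement's English description precedes it below -/
import Mathlib

section
/- With the rank notation below, the three p-values satisfy p_− < p^{erl} ≤ p_+, where p_+ = (1/s)·#{ i ∈ {1,…,s} : R_i ≤ R_1 }, p_− = (1/s)·#{ i ∈ {1,…,s} : R_i < R_1 }, and p^{erl} = 1 − (1/s)·#{ i ∈ {1,…,s} : 𝐑_1 ≺ 𝐑_i }. -/
/-- The raw rank `r_{ik}`: the number of indices `i′` with `V_{i′k} ≤ V_{ik}` (so the smallest
value in coordinate `k` has raw rank 1, assuming no pointwise ties). -/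
noncomputable def rawRank {s d : ℕ} (V : Fin s → Fin d → ℝ) (i : Fin s) (k : Fin d) : ℕ :=
  Nat.card {i' : Fin s // V i' k ≤ V i k}

/-- The two-sided pointwise rank `R_{ik} = min(r_{ik}, s + 1 − r_{ik})`. -/
noncomputable def ptwRank {s d : ℕ} (V : Fin s → Fin d → ℝ) (i : Fin s) (k : Fin d) : ℕ :=
  min (rawRank V i k) (s + 1 - rawRank V i k)

/-- The extreme rank `R_i = min_{k} R_{ik}`. -/
noncomputable def extremeRank {s d : ℕ} (V : Fin s → Fin d → ℝ) (i : Fin s) : ℕ :=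
  ⨅ k : Fin d, ptwRank V i k

/-- The sorted rank vector `𝐑_i`: the nondecreasing rearrangement of `(R_{i1}, …, R_{id})`. -/
noncomputable def sortedRank {s d : ℕ} (V : Fin s → Fin d → ℝ) (i : Fin s) : Fin d → ℕ :=
  fun k => ptwRank V i (Tuple.sort (ptwRank V i) k)

/-- Strict lexicographic order on (sorted) rank vectors: `a ≺ b` iff there exists `n` with
`a k = b k` for all `k < n` and `a n < b n`. -/
def lexLT {d : ℕ} (a b : Fin d → ℕ) : Prop :=
  ∃ n : Fin d, (∀ k : Fin d, k < n → a k = b k) ∧ a n < b n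

/-- `s` times the extreme rank length measure: the number of indices `i′` with `𝐑_{i′} ≺ 𝐑_i`. -/
noncomputable def erlCount {s d : ℕ} (V : Fin s → Fin d → ℝ) (i : Fin s) : ℕ :=
  Nat.card {i' : Fin s // lexLT (sortedRank V i') (sortedRank V i)}

/-- The extreme rank length measure `R_i^{erl} = (1/s)·#{ i′ : 𝐑_{i′} ≺ 𝐑_i }`. -/
noncomputable def erl {s d : ℕ} (V : Fin s → Fin d → ℝ) (i : Fin s) : ℝ :=
  (erlCount V i : ℝ) / s

theorem extremeRank_eq_sortedRank_zero {s d : ℕ} (hd : 0 < d) (V : Fin s → Fin d → ℝ)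
    (i : Fin s) : extremeRank V i = sortedRank V i ⟨0, hd⟩ := by
  have : Nonempty (Fin d) := ⟨⟨0, hd⟩⟩
  refine le_antisymm (ciInf_le' _ _) (le_ciInf fun k => ?_)
  have h := Tuple.monotone_sort (ptwRank V i)
    (show (⟨0, hd⟩ : Fin d) ≤ (Tuple.sort (ptwRank V i)).symm k from Nat.zero_le _)
  simpa [sortedRank] using h

theorem lexLT_irrefl {d : ℕ} (a : Fin d → ℕ) : ¬ lexLT a a :=
  fun ⟨_, _, h⟩ => lt_irrefl _ h

theorem lexLT.apply_zero_le {d : ℕ} (hd : 0 < d) {a b : Fin d → ℕ} (h : lexLT a b) :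
    a ⟨0, hd⟩ ≤ b ⟨0, hd⟩ := by
  obtain ⟨n, heq, hlt⟩ := h
  rcases (show (⟨0, hd⟩ : Fin d) ≤ n from Nat.zero_le _).eq_or_lt with h0 | h0
  · exact h0 ▸ hlt.le
  · exact (heq _ h0).le

theorem lexLT_of_apply_zero_lt {d : ℕ} (hd : 0 < d) {a b : Fin d → ℕ}
    (h : a ⟨0, hd⟩ < b ⟨0, hd⟩) : lexLT a b :=
  ⟨⟨0, hd⟩, fun _ hk => absurd hk (Nat.not_lt_zero _), h⟩

theorem card_lt_add_card_lexLT_lt {s d : ℕ} (hd : 0 < d) (V : Fin s → Fin d → ℝ) (j : Fin s) :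
    Nat.card {i : Fin s // extremeRank V i < extremeRank V j} +
      Nat.card {i : Fin s // lexLT (sortedRank V j) (sortedRank V i)} < s := by
  classical
  rw [Nat.card_eq_fintype_card, Nat.card_eq_fintype_card, Fintype.card_subtype,
    Fintype.card_subtype, ← Finset.card_union_of_disjoint]
  · refine (Finset.card_lt_univ_of_notMem (x := j) ?_).trans_eq (Fintype.card_fin s)
    simp [lexLT_irrefl]
  · refine Finset.disjoint_filter.2 fun i _ hlt hlex => ?_
    rw [extremeRank_eq_sortedRank_zero hd, extremeRank_eq_sortedRank_zero hd] at hlt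
    exact hlt.not_ge (hlex.apply_zero_le hd)

theorem le_card_le_add_card_lexLT {s d : ℕ} (hd : 0 < d) (V : Fin s → Fin d → ℝ) (j : Fin s) :
    s ≤ Nat.card {i : Fin s // extremeRank V i ≤ extremeRank V j} +
      Nat.card {i : Fin s // lexLT (sortedRank V j) (sortedRank V i)} := by
  classical
  rw [Nat.card_eq_fintype_card, Nat.card_eq_fintype_card, Fintype.card_subtype,
    Fintype.card_subtype]
  refine le_trans ?_ (Finset.card_union_le _ _)
  rw [Finset.eq_univ_of_forall (s := _ ∪ _), Finset.card_univ, Fintype.card_fin]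
  intro i
  simp only [Finset.mem_union, Finset.mem_filter, Finset.mem_univ, true_and]
  refine (le_or_gt _ _).imp_right fun h => lexLT_of_apply_zero_lt hd ?_
  rwa [extremeRank_eq_sortedRank_zero hd, extremeRank_eq_sortedRank_zero hd] at h

/-- The ordering `p_− < p^{erl} ≤ p_+` of the liberal, extreme-rank-length and conservative
p-values of the global rank envelope test (Proposition 6.1 of Myllymäki et al. (2017), as used
in the paper). Index `⟨0, hs⟩` plays the role of the observed test vector `𝐑_1`. -/
theorem pvalues_ordered {s d : ℕ} (hs : 0 < s) (hd : 0 < d)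
    (V : Fin s → Fin d → ℝ)
    (hnoties : ∀ k : Fin d, Function.Injective fun i => V i k) :
    let one : Fin s := ⟨0, hs⟩
    let pplus : ℝ :=
      (Nat.card {i : Fin s // extremeRank V i ≤ extremeRank V one} : ℝ) / s
    let pminus : ℝ :=
      (Nat.card {i : Fin s // extremeRank V i < extremeRank V one} : ℝ) / s
    let perl : ℝ :=
      1 - (Nat.card {i : Fin s // lexLT (sortedRank V one) (sortedRank V i)} : ℝ) / s
    pminus < perl ∧ perl ≤ pplus := by
  intro one pplus pminus perl
  have hs' : (0 : ℝ) < s := Nat.cast_pos.2 hs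
  constructor
  · have h : (_ : ℝ) < s := Nat.cast_lt.2 (card_lt_add_card_lexLT_lt hd V one)
    rw [Nat.cast_add] at h
    rw [lt_sub_iff_add_lt, ← add_div, div_lt_one hs']
    exact h
  · have h : (s : ℝ) ≤ _ := Nat.cast_le.2 (le_card_le_add_card_lexLT hd V one)
    rw [Nat.cast_add] at h
    rw [sub_le_iff_le_add, ← add_div, one_le_div hs']
    exact h
end

section
/- With the rank and envelope notation below and α ∈ (0,1): (1) there exists k ∈ {1,…,d} with V_{1k} < V_{low,k}^{(α)} or V_{1k} > V_{upp,k}^{(α)} if and only if p^{erl} ≤ α; (2) V_{low,k}^{(α)} ≤ V_{1k} ≤ V_{upp,k}^{(α)} for all k ∈ {1,…,d} if and only if p^{erl} > α. That is, the global extreme rank length envelope test and the p-value p^{erl} give equivalent inference. -/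
/-- Counting the strictly smaller values of a finite family preserves and reflects `<`. -/
theorem card_lt_lt_card_lt_iff {ι β : Type*} [Finite ι] [LinearOrder β] (f : ι → β) (i j : ι) :
    Nat.card {x // f x < f i} < Nat.card {x // f x < f j} ↔ f i < f j := by
  constructor
  · intro h
    by_contra! hle
    exact absurd h (not_lt.2 (Nat.card_mono (Set.toFinite {x | f x < f i})
      (fun x (hx : f x < f j) => lt_of_lt_of_le hx hle)))
  · intro h
    refine Set.ncard_lt_ncard (s := {x | f x < f i}) (t := {x | f x < f j}) ?_ (Set.toFinite _)
    exact ⟨fun x (hx : f x < f i) => hx.trans h, fun hs => lt_irrefl _ (hs (a := i) h)⟩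

theorem erl_lt_erl_iff {s d : ℕ} (V : Fin s → Fin d → ℝ) (i j : Fin s) :
    erl V i < erl V j ↔ lexLT (sortedRank V i) (sortedRank V j) := by
  have hs : (0 : ℝ) < s := by exact_mod_cast i.pos
  unfold erl
  rw [div_lt_div_iff_of_pos_right hs, Nat.cast_lt]
  exact card_lt_lt_card_lt_iff (fun x => toLex (sortedRank V x)) i j

theorem sortedRank_zero_le {s d : ℕ} (hd : 0 < d) (V : Fin s → Fin d → ℝ) (i : Fin s)
    (k : Fin d) : sortedRank V i ⟨0, hd⟩ ≤ ptwRank V i k := by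
  have h := Tuple.monotone_sort (ptwRank V i)
    (show (⟨0, hd⟩ : Fin d) ≤ (Tuple.sort (ptwRank V i)).symm k from Nat.zero_le _)
  simpa [sortedRank] using h

theorem rawRank_lt_rawRank {s d : ℕ} {V : Fin s → Fin d → ℝ} {i j : Fin s} {k : Fin d}
    (h : V i k < V j k) : rawRank V i k < rawRank V j k := by
  refine Set.ncard_lt_ncard (s := {x | V x k ≤ V i k}) (t := {x | V x k ≤ V j k}) ?_
    (Set.toFinite _)
  exact ⟨fun x (hx : V x k ≤ V i k) => hx.trans h.le,
    fun hs => not_le.2 h (hs (a := j) (le_refl (V j k)))⟩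

theorem rawRank_le {s d : ℕ} (V : Fin s → Fin d → ℝ) (i : Fin s) (k : Fin d) :
    rawRank V i k ≤ s := by
  simpa [rawRank] using Finite.card_subtype_le (fun x => V x k ≤ V i k)

/-- A vector whose sorted rank vector strictly precedes all those indexed by `I` leaves the
range spanned by `I` in some coordinate. -/
theorem exists_coord_outside {s d : ℕ} (hd : 0 < d) {V : Fin s → Fin d → ℝ} {I : Set (Fin s)}
    {j : Fin s} (hI : ∀ i ∈ I, lexLT (sortedRank V j) (sortedRank V i)) :
    ∃ k, (∀ i ∈ I, V j k ≤ V i k) ∨ ∀ i ∈ I, V i k ≤ V j k := by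
  refine ⟨Tuple.sort (ptwRank V j) ⟨0, hd⟩, ?_⟩
  set k := Tuple.sort (ptwRank V j) ⟨0, hd⟩ with hk
  have hmin : ∀ i ∈ I, ptwRank V j k ≤ ptwRank V i k := fun i hi =>
    ((hI i hi).apply_zero_le hd).trans (sortedRank_zero_le hd V i k)
  by_contra! h
  obtain ⟨⟨a, ha, hlt⟩, b, hb, hgt⟩ := h
  have h1 := rawRank_lt_rawRank hlt
  have h2 := rawRank_lt_rawRank hgt
  have h3 := hmin a ha
  have h4 := hmin b hb
  have h5 := rawRank_le V b k
  simp only [ptwRank] at h3 h4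
  omega

/-- The critical value `c` separates the values `f j` by the number of indices at or below. -/
theorem lt_critical_iff {ι : Type*} [Finite ι] {f : ι → ℝ} {c m : ℝ} (hm : m < Nat.card ι)
    (hc_le : (Nat.card {i // f i < c} : ℝ) ≤ m)
    (hc_max : ∀ i, (Nat.card {x // f x < f i} : ℝ) ≤ m → f i ≤ c) (j : ι) :
    f j < c ↔ (Nat.card {i // f i ≤ f j} : ℝ) ≤ m := by
  constructor
  · intro h
    refine le_trans ?_ hc_le
    exact_mod_cast Nat.card_mono (Set.toFinite {i | f i < c})
      (fun x (hx : f x ≤ f j) => lt_of_le_of_lt hx h)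
  · intro h
    have hne : {i | f j < f i}.Nonempty := by
      by_contra! hemp
      have hall : ∀ i, f i ≤ f j := fun i => not_lt.1 fun hi => by
        have : i ∈ {i | f j < f i} := hi
        simp [hemp] at this
      have : Nat.card {i // f i ≤ f j} = Nat.card ι :=
        Nat.card_congr (Equiv.subtypeUnivEquiv hall)
      rw [this] at h
      linarith
    obtain ⟨i, hi, hmin⟩ := Set.exists_min_image _ f (Set.toFinite _) hne
    refine lt_of_lt_of_le hi (hc_max i (le_trans ?_ h))
    exact_mod_cast Nat.card_mono (Set.toFinite {i | f i ≤ f j})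
      (fun x (hx : f x < f i) => show f x ≤ f j from
        not_lt.1 fun hj => not_lt.2 (hmin x hj) hx)

/-- Theorem 1: equivalence of the global extreme rank length envelope and the p-value `p^{erl}`.
Here `c` plays the role of the critical value `R_{(α)}^{erl}`: it is the largest value among
`R_1^{erl}, …, R_s^{erl}` such that `#{i : R_i^{erl} < c} ≤ αs`; the envelope is spanned by the
vectors of the index set `I_α = {i : R_i^{erl} ≥ c}`, and index `⟨0, hs⟩` is the observed vector. -/
theorem erl_envelope_iff_pvalue {s d : ℕ} (hs : 0 < s) (hd : 0 < d)
    {α : ℝ} (hα : α ∈ Set.Ioo (0 : ℝ) 1)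
    (V : Fin s → Fin d → ℝ)
    (hnoties : ∀ k : Fin d, Function.Injective fun i => V i k)
    (c : ℝ) (hc_mem : ∃ i : Fin s, erl V i = c)
    (hc_le : (Nat.card {i : Fin s // erl V i < c} : ℝ) ≤ α * s)
    (hc_max : ∀ i : Fin s,
      (Nat.card {i' : Fin s // erl V i' < erl V i} : ℝ) ≤ α * s → erl V i ≤ c)
    (low upp : Fin d → ℝ)
    (hlow : ∀ k : Fin d, low k = sInf ((fun i => V i k) '' {i : Fin s | c ≤ erl V i}))
    (hupp : ∀ k : Fin d, upp k = sSup ((fun i => V i k) '' {i : Fin s | c ≤ erl V i})) :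
    let one : Fin s := ⟨0, hs⟩
    let perl : ℝ :=
      1 - (Nat.card {i : Fin s // lexLT (sortedRank V one) (sortedRank V i)} : ℝ) / s
    ((∃ k : Fin d, V one k < low k ∨ upp k < V one k) ↔ perl ≤ α) ∧
      ((∀ k : Fin d, low k ≤ V one k ∧ V one k ≤ upp k) ↔ α < perl) := by
  intro one perl
  have hs' : (0 : ℝ) < s := by exact_mod_cast hs
  have hfin : ∀ k, ((fun i => V i k) '' {i : Fin s | c ≤ erl V i}).Finite :=
    fun k => (Set.toFinite _).image _
  have hne : ∀ k, ((fun i => V i k) '' {i : Fin s | c ≤ erl V i}).Nonempty := by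
    obtain ⟨i, hi⟩ := hc_mem
    exact fun k => ⟨_, i, hi.ge, rfl⟩
  have hperl : perl ≤ α ↔ erl V one < c := by
    have hm : α * s < Nat.card (Fin s) := by
      rw [Nat.card_fin]
      exact mul_lt_of_lt_one_left hs' hα.2
    rw [lt_critical_iff hm hc_le hc_max one]
    have hcompl : Nat.card {i // erl V i ≤ erl V one} +
        Nat.card {i : Fin s // lexLT (sortedRank V one) (sortedRank V i)} = s := by
      have h := Set.ncard_add_ncard_compl {i | erl V i ≤ erl V one}
      have hset : {i | erl V i ≤ erl V one}ᶜ =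
          {i : Fin s | lexLT (sortedRank V one) (sortedRank V i)} := by
        ext i
        simp [← erl_lt_erl_iff]
      rw [hset, Nat.card_fin] at h
      exact h
    have hcompl' : (Nat.card {i // erl V i ≤ erl V one} : ℝ) +
        Nat.card {i : Fin s // lexLT (sortedRank V one) (sortedRank V i)} = s := by
      exact_mod_cast hcompl
    rw [show perl = (Nat.card {i // erl V i ≤ erl V one} : ℝ) / s by
      simp only [perl]
      field_simp
      linarith, div_le_iff₀ hs']
  have houtside : (∃ k : Fin d, V one k < low k ∨ upp k < V one k) ↔ erl V one < c := by
    constructor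
    · rintro ⟨k, hk⟩
      by_contra! hc
      have hmem : V one k ∈ (fun i => V i k) '' {i : Fin s | c ≤ erl V i} := ⟨one, hc, rfl⟩
      rw [hlow, hupp] at hk
      exact hk.elim (not_lt.2 (csInf_le (hfin k).bddBelow hmem))
        (not_lt.2 (le_csSup (hfin k).bddAbove hmem))
    · intro hc
      obtain ⟨k, hk⟩ := exists_coord_outside (I := {i | c ≤ erl V i}) hd
        fun i hi => (erl_lt_erl_iff V one i).1 (hc.trans_le hi)
      have hVne : ∀ i, c ≤ erl V i → V i k ≠ V one k := fun i hi h =>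
        not_lt.2 hi ((hnoties k h) ▸ hc)
      refine ⟨k, hk.imp (fun h => ?_) fun h => ?_⟩
      · obtain ⟨i, hi, hik⟩ := (hne k).csInf_mem (hfin k)
        rw [hlow, ← hik]
        exact lt_of_le_of_ne (h i hi) (hVne i hi).symm
      · obtain ⟨i, hi, hik⟩ := (hne k).csSup_mem (hfin k)
        rw [hupp, ← hik]
        exact lt_of_le_of_ne (h i hi) (hVne i hi)
  have hiff := houtside.trans hperl.symm
  refine ⟨hiff, ?_⟩
  rw [← not_le, ← hiff]
  push Not
  rfl
end

section
/- With the rank notation below and α ∈ (0,1), let l_α = max{ l ∈ ℕ, l ≥ 1 : #{ i : R_i < l } ≤ αs } be the critical rank of the 100(1−α)% global rank envelope, let I_{l_α} = { i ∈ {1,…,s} : R_i ≥ l_α }, let R_{(α)}^{erl} be the largest value among R_1^{erl}, …, R_s^{erl} such that #{ i : R_i^{erl} < R_{(α)}^{erl} } ≤ αs, and let I_α = { i ∈ {1,…,s} : R_i^{erl} ≥ R_{(α)}^{erl} }. Then I_α ⊆ I_{l_α}; i.e., every vector retained by the extreme rank length criterion has extreme rank at least l_α. -/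
theorem lexLT.trans {d : ℕ} {a b c : Fin d → ℕ} (hab : lexLT a b) (hbc : lexLT b c) :
    lexLT a c := by
  obtain ⟨m, hm, hm'⟩ := hab
  obtain ⟨n, hn, hn'⟩ := hbc
  rcases lt_trichotomy m n with h | rfl | h
  · exact ⟨m, fun k hk => (hm k hk).trans (hn k (hk.trans h)), hn m h ▸ hm'⟩
  · exact ⟨m, fun k hk => (hm k hk).trans (hn k hk), hm'.trans hn'⟩
  · exact ⟨n, fun k hk => (hm k (hk.trans h)).trans (hn k hk), (hm n h).symm ▸ hn'⟩

theorem extremeRank_le_ptwRank {s d : ℕ} (V : Fin s → Fin d → ℝ) (i : Fin s) (k : Fin d) :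
    extremeRank V i ≤ ptwRank V i k :=
  ciInf_le (OrderBot.bddBelow _) k

theorem sortedRank_zero_le_extremeRank {s d : ℕ} (hd : 0 < d) (V : Fin s → Fin d → ℝ)
    (i : Fin s) : sortedRank V i ⟨0, hd⟩ ≤ extremeRank V i := by
  have : Nonempty (Fin d) := ⟨⟨0, hd⟩⟩
  refine le_ciInf fun k => ?_
  obtain ⟨m, rfl⟩ := (Tuple.sort (ptwRank V i)).surjective k
  exact Tuple.monotone_sort (ptwRank V i) (Fin.mk_le_of_le_val (Nat.zero_le _))

theorem lexLT_sortedRank_of_extremeRank_lt {s d : ℕ} (hd : 0 < d) (V : Fin s → Fin d → ℝ)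
    {i j : Fin s} (h : extremeRank V i < extremeRank V j) :
    lexLT (sortedRank V i) (sortedRank V j) :=
  ⟨⟨0, hd⟩, fun k hk => absurd hk (Nat.not_lt_zero k),
    (sortedRank_zero_le_extremeRank hd V i).trans_lt (h.trans_le (extremeRank_le_ptwRank V j _))⟩

theorem erl_lt_erl_of_lexLT {s d : ℕ} (V : Fin s → Fin d → ℝ) {i j : Fin s}
    (h : lexLT (sortedRank V i) (sortedRank V j)) : erl V i < erl V j := by
  have hs : (0 : ℝ) < s := Nat.cast_pos.2 i.pos
  have hcount : erlCount V i < erlCount V j :=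
    Set.ncard_lt_ncard (s := {k | lexLT (sortedRank V k) (sortedRank V i)})
      (t := {k | lexLT (sortedRank V k) (sortedRank V j)})
      ⟨fun _ hk => hk.trans h, fun hsub => lexLT_irrefl _ (hsub h)⟩ (Set.toFinite _)
  exact div_lt_div_of_pos_right (Nat.cast_lt.2 hcount) hs

/-- Every vector retained by the extreme rank length criterion has extreme rank at least the
critical rank: `I_α ⊆ I_{l_α}`. Here `lα` is the critical rank of the `100(1−α)%` global rank
envelope (the largest `l ≥ 1` with `#{i : R_i < l} ≤ αs`), and `c` is the critical value
`R_{(α)}^{erl}` (the largest value among `R_1^{erl}, …, R_s^{erl}` with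
`#{i : R_i^{erl} < c} ≤ αs`). -/
theorem erl_index_set_subset_rank_index_set {s d : ℕ} (hs : 0 < s) (hd : 0 < d)
    {α : ℝ} (hα : α ∈ Set.Ioo (0 : ℝ) 1)
    (V : Fin s → Fin d → ℝ)
    (hnoties : ∀ k : Fin d, Function.Injective fun i => V i k)
    (lα : ℕ) (hlα1 : 1 ≤ lα)
    (hlα2 : (Nat.card {i : Fin s // extremeRank V i < lα} : ℝ) ≤ α * s)
    (hlα3 : ∀ l : ℕ, 1 ≤ l →
      (Nat.card {i : Fin s // extremeRank V i < l} : ℝ) ≤ α * s → l ≤ lα)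
    (c : ℝ) (hc_mem : ∃ i : Fin s, erl V i = c)
    (hc_le : (Nat.card {i : Fin s // erl V i < c} : ℝ) ≤ α * s)
    (hc_max : ∀ i : Fin s,
      (Nat.card {i' : Fin s // erl V i' < erl V i} : ℝ) ≤ α * s → erl V i ≤ c) :
    {i : Fin s | c ≤ erl V i} ⊆ {i : Fin s | lα ≤ extremeRank V i} := by
  intro i hi
  simp only [Set.mem_ofPred_eq] at hi ⊢
  by_contra! hlt
  have hs' : (0 : ℝ) < s := Nat.cast_pos.2 hs
  have hne : {j : Fin s | lα ≤ extremeRank V j}.Nonempty := by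
    by_contra! hempty
    have hall : ∀ j, extremeRank V j < lα := fun j => by
      by_contra! hj
      exact (Set.eq_empty_iff_forall_notMem.1 hempty j) hj
    have hcard : Nat.card {j : Fin s // extremeRank V j < lα} = s := by
      simp [hall]
    rw [hcard] at hlα2
    nlinarith [hα.2]
  obtain ⟨j, hj, hmin⟩ :=
    Set.exists_min_image {j : Fin s | lα ≤ extremeRank V j} (erl V) (Set.toFinite _) hne
  have hsub : Nat.card {k : Fin s // erl V k < erl V j} ≤
      Nat.card {k : Fin s // extremeRank V k < lα} :=
    Set.ncard_le_ncard (s := {k | erl V k < erl V j}) (t := {k | extremeRank V k < lα})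
      (fun k hk => (not_le.1 fun hk' => (hmin k hk').not_gt hk : extremeRank V k < lα))
      (Set.toFinite _)
  have hjc : erl V j ≤ c := hc_max j ((Nat.cast_le.2 hsub).trans hlα2)
  have hij : erl V i < erl V j :=
    erl_lt_erl_of_lexLT V (lexLT_sortedRank_of_extremeRank_lt hd V (hlt.trans_le hj))
  exact (hij.trans_le (hjc.trans hi)).false
end

section
/- Let (Ω, 𝓕, P) be a probability space, let s and d be positive integers, let α ∈ (0,1), and let V_1, …, V_s : Ω → ℝ^d be random vectors whose joint distribution is invariant under every permutation of the indices 1, …, s (exchangeable). Assume that almost surely, for each coordinate k the values V_{1k}, …, V_{sk} are pairwise distinct and the sorted rank vectors 𝐑_1, …, 𝐑_s are pairwise distinct. Then P( p^{erl} ≤ α ) = ⌊sα⌋ / s; in particular P( p^{erl} ≤ α ) ≤ α, so the global extreme rank length envelope test is an exact Monte Carlo test. -/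
open MeasureTheory

/-- The number of indices `i` with `𝐑_j ≺ 𝐑_i`. -/
noncomputable def numAbove {s d : ℕ} (v : Fin s → Fin d → ℝ) (j : Fin s) : ℕ :=
  Nat.card {i : Fin s // lexLT (sortedRank v j) (sortedRank v i)}

lemma numAbove_le {s d : ℕ} (v : Fin s → Fin d → ℝ) (j : Fin s) : numAbove v j ≤ s := by
  simpa [numAbove] using Finite.card_subtype_le fun i : Fin s => lexLT (sortedRank v j) (sortedRank v i)

lemma rawRank_comp_perm {s d : ℕ} (v : Fin s → Fin d → ℝ) (σ : Equiv.Perm (Fin s))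
    (i : Fin s) : rawRank (fun i' => v (σ i')) i = rawRank v (σ i) := by
  funext k
  exact Nat.card_congr (σ.subtypeEquiv fun _ => Iff.rfl)

lemma sortedRank_comp_perm {s d : ℕ} (v : Fin s → Fin d → ℝ) (σ : Equiv.Perm (Fin s))
    (i : Fin s) : sortedRank (fun i' => v (σ i')) i = sortedRank v (σ i) := by
  have h : ptwRank (fun i' => v (σ i')) i = ptwRank v (σ i) := by
    funext k
    simp only [ptwRank, rawRank_comp_perm]
  funext k
  simp only [sortedRank, h]

lemma numAbove_comp_perm {s d : ℕ} (v : Fin s → Fin d → ℝ) (σ : Equiv.Perm (Fin s))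
    (j : Fin s) : numAbove (fun i => v (σ i)) j = numAbove v (σ j) := by
  refine Nat.card_congr (σ.subtypeEquiv fun i => ?_)
  rw [sortedRank_comp_perm, sortedRank_comp_perm]

lemma measurable_rawRank {s d : ℕ} :
    Measurable fun (v : Fin s → Fin d → ℝ) (i : Fin s) (k : Fin d) => rawRank v i k := by
  classical
  refine measurable_pi_lambda _ fun i => measurable_pi_lambda _ fun k => ?_
  have h : (fun v : Fin s → Fin d → ℝ => rawRank v i k) =
      fun v => ∑ i' : Fin s, if v i' k ≤ v i k then 1 else 0 := by
    funext v
    rw [rawRank, Nat.card_eq_fintype_card, Fintype.card_subtype, Finset.card_filter]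
  rw [h]
  refine Finset.measurable_sum _ fun i' _ => Measurable.ite ?_ measurable_const measurable_const
  exact measurableSet_le (by fun_prop) (by fun_prop)

lemma measurable_numAbove {s d : ℕ} (j : Fin s) :
    Measurable fun v : Fin s → Fin d → ℝ => numAbove v j := by
  let p : (Fin s → Fin d → ℕ) → Fin s → Fin d → ℕ := fun r i k => min (r i k) (s + 1 - r i k)
  let q : (Fin s → Fin d → ℕ) → Fin s → Fin d → ℕ := fun r i k => p r i (Tuple.sort (p r i) k)
  have h : Measurable fun r => Nat.card {i : Fin s // lexLT (q r j) (q r i)} :=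
    measurable_of_countable _
  exact h.comp measurable_rawRank

/-- For an injective family in a linear order, exactly `m` members have at least `s - m` members
strictly above them. -/
lemma card_le_card_gt_add {L : Type*} [LinearOrder L] {s m : ℕ} (hm : m ≤ s) (f : Fin s → L)
    (hf : Function.Injective f) :
    Nat.card {j : Fin s // s ≤ Nat.card {i : Fin s // f j < f i} + m} = m := by
  classical
  have hc (j : Fin s) :
      Nat.card {i : Fin s // f j < f i} = (Finset.univ.filter (f j < f ·)).card := by
    rw [Nat.card_eq_fintype_card, Fintype.card_subtype]
  have hlt (j : Fin s) : Nat.card {i : Fin s // f j < f i} < s := by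
    rw [hc]
    refine (Finset.card_lt_univ_of_notMem (x := j) (by simp)).trans_eq (by simp)
  let g : Fin s → Fin s := fun j => ⟨_, hlt j⟩
  have hanti {a b : Fin s} (hab : f a < f b) : g b < g a := by
    change Nat.card {i : Fin s // f b < f i} < Nat.card {i : Fin s // f a < f i}
    rw [hc, hc]
    refine Finset.card_lt_card (Finset.ssubset_iff_of_subset ?_ |>.2 ⟨b, by simpa, by simp⟩)
    intro i hi
    simp only [Finset.mem_filter_univ] at hi ⊢
    exact hab.trans hi
  have hg : Function.Injective g := by
    intro a b hab
    by_contra hne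
    rcases lt_or_gt_of_ne (hf.ne hne) with h | h
    · exact (hanti h).ne' hab
    · exact (hanti h).ne hab
  let e : Fin s ≃ Fin s := Equiv.ofBijective g (Finite.injective_iff_bijective.1 hg)
  rw [Nat.card_congr (e.subtypeEquiv (p := fun j => s ≤ Nat.card {i : Fin s // f j < f i} + m)
      (q := fun t : Fin s => s ≤ (t : ℕ) + m) fun _ => Iff.rfl),
    Nat.card_congr (Fin.revPerm.subtypeEquiv (q := fun t : Fin s => (t : ℕ) < m) fun t => by
      simp only [Fin.revPerm_apply, Fin.val_rev]; omega),
    Nat.card_eq_fintype_card, Fintype.card_subtype]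
  rw [Fin.card_filter_val_lt, min_eq_right hm]

lemma card_le_numAbove_add {s d m : ℕ} (hm : m ≤ s) (v : Fin s → Fin d → ℝ)
    (hv : Function.Injective (sortedRank v)) :
    Nat.card {j : Fin s // s ≤ numAbove v j + m} = m :=
  card_le_card_gt_add hm (fun i => toLex (sortedRank v i)) (toLex.injective.comp hv)

/-- Under exchangeability, each index is among the `m` most extreme ones with probability
`m / s`. -/
lemma mul_measure_le_numAbove_add {Ω : Type*} [MeasurableSpace Ω] (P : Measure Ω)
    [IsProbabilityMeasure P] {s d m : ℕ} (hm : m ≤ s)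
    (V : Fin s → Ω → Fin d → ℝ) (hmeas : ∀ i, Measurable (V i))
    (hexch : ∀ σ : Equiv.Perm (Fin s),
      Measure.map (fun ω => fun i => V (σ i) ω) P =
        Measure.map (fun ω => fun i => V i ω) P)
    (hties : ∀ᵐ ω ∂P, Function.Injective (sortedRank fun i => V i ω)) (j₀ : Fin s) :
    s * P {ω | s ≤ numAbove (fun i => V i ω) j₀ + m} = m := by
  classical
  have hA (j : Fin s) : MeasurableSet {v : Fin s → Fin d → ℝ | s ≤ numAbove v j + m} :=
    measurableSet_le measurable_const ((measurable_numAbove j).add_const m)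
  have hX : Measurable fun ω i => V i ω := measurable_pi_lambda _ hmeas
  have hB (j : Fin s) : MeasurableSet {ω | s ≤ numAbove (fun i => V i ω) j + m} := hX (hA j)
  have heq (j : Fin s) : P {ω | s ≤ numAbove (fun i => V i ω) j + m} =
      P {ω | s ≤ numAbove (fun i => V i ω) j₀ + m} := by
    have h := congrArg (fun μ => μ {v | s ≤ numAbove v j₀ + m}) (hexch (Equiv.swap j₀ j))
    rw [Measure.map_apply (measurable_pi_lambda _ fun i => hmeas _) (hA j₀),
      Measure.map_apply hX (hA j₀)] at h
    simp only [Set.preimage_ofPred_eq] at h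
    rw [← h]
    congr 1
    ext ω
    have hswap := numAbove_comp_perm (fun i => V i ω) (Equiv.swap j₀ j) j₀
    rw [Equiv.swap_apply_left] at hswap
    simp only [Set.mem_ofPred_eq, hswap]
  calc s * P {ω | s ≤ numAbove (fun i => V i ω) j₀ + m}
      = ∑ j : Fin s, P {ω | s ≤ numAbove (fun i => V i ω) j + m} := by simp [heq]
    _ = ∑ j : Fin s, ∫⁻ ω, {ω | s ≤ numAbove (fun i => V i ω) j + m}.indicator 1 ω ∂P := by
        simp only [lintegral_indicator_one (hB _)]
    _ = ∫⁻ ω, ∑ j : Fin s, {ω | s ≤ numAbove (fun i => V i ω) j + m}.indicator 1 ω ∂P :=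
        (lintegral_finsetSum _ fun j _ => measurable_one.indicator (hB j)).symm
    _ = ∫⁻ _, m ∂P := by
        refine lintegral_congr_ae ?_
        filter_upwards [hties] with ω hω
        have h := card_le_numAbove_add hm _ hω
        rw [Nat.card_eq_fintype_card, Fintype.card_subtype, Finset.card_filter] at h
        simp only [Set.indicator_apply, Set.mem_ofPred_eq, Pi.one_apply]
        exact_mod_cast congrArg (Nat.cast : ℕ → ENNReal) h
    _ = m := by simp

/-- Exactness of the global extreme rank length envelope test: if the random vectors
`V_1, …, V_s : Ω → ℝ^d` are exchangeable and almost surely have no pointwise ties and pairwise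
distinct sorted rank vectors, then `P(p^{erl} ≤ α) = ⌊sα⌋/s ≤ α`. Index `⟨0, hs⟩` plays the
role of the observed (identity-permutation) test vector. -/
theorem erl_test_exact {Ω : Type*} [MeasurableSpace Ω] (P : Measure Ω)
    [IsProbabilityMeasure P]
    {s d : ℕ} (hs : 0 < s) (hd : 0 < d)
    {α : ℝ} (hα : α ∈ Set.Ioo (0 : ℝ) 1)
    (V : Fin s → Ω → Fin d → ℝ)
    (hmeas : ∀ i, Measurable (V i))
    (hexch : ∀ σ : Equiv.Perm (Fin s),
      Measure.map (fun ω => fun i => V (σ i) ω) P =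
        Measure.map (fun ω => fun i => V i ω) P)
    (hties : ∀ᵐ ω ∂P,
      (∀ k : Fin d, Function.Injective fun i => V i ω k) ∧
        Function.Injective fun i : Fin s => sortedRank (fun i' => V i' ω) i) :
    let perl : Ω → ℝ := fun ω =>
      1 - (Nat.card {i : Fin s //
            lexLT (sortedRank (fun i' => V i' ω) ⟨0, hs⟩)
              (sortedRank (fun i' => V i' ω) i)} : ℝ) / s
    P {ω | perl ω ≤ α} = ENNReal.ofReal ((⌊(s : ℝ) * α⌋ : ℝ) / s) ∧
      P {ω | perl ω ≤ α} ≤ ENNReal.ofReal α := by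
  intro perl
  have hs' : (0 : ℝ) < s := by exact_mod_cast hs
  have hsα : 0 ≤ (s : ℝ) * α := mul_nonneg hs'.le hα.1.le
  have hfl : (⌊(s : ℝ) * α⌋₊ : ℝ) ≤ s * α := Nat.floor_le hsα
  have hm : ⌊(s : ℝ) * α⌋₊ ≤ s := by
    refine Nat.floor_le_of_le ?_
    nlinarith [hα.2]
  have hset : {ω | perl ω ≤ α} =
      {ω | s ≤ numAbove (fun i => V i ω) ⟨0, hs⟩ + ⌊(s : ℝ) * α⌋₊} := by
    ext ω
    have hle := numAbove_le (fun i => V i ω) ⟨0, hs⟩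
    change 1 - (numAbove (fun i => V i ω) ⟨0, hs⟩ : ℝ) / s ≤ α ↔ s ≤ _
    rw [← Nat.sub_le_iff_le_add', Nat.le_floor_iff hsα, Nat.cast_sub hle, one_sub_div hs'.ne',
      div_le_iff₀' hs']
  have hmul := mul_measure_le_numAbove_add P hm V hmeas hexch (hties.mono fun ω h => h.2) ⟨0, hs⟩
  have hfloor : (⌊(s : ℝ) * α⌋ : ℝ) = ⌊(s : ℝ) * α⌋₊ := by
    exact_mod_cast (Int.natCast_floor_eq_floor hsα).symm
  have hP : P {ω | perl ω ≤ α} = ENNReal.ofReal ((⌊(s : ℝ) * α⌋ : ℝ) / s) := by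
    rw [hset, hfloor, ENNReal.ofReal_div_of_pos hs', ENNReal.ofReal_natCast,
      ENNReal.ofReal_natCast, ENNReal.eq_div_iff (by exact_mod_cast hs.ne') (by simp), hmul]
  refine ⟨hP, hP.trans_le (ENNReal.ofReal_le_ofReal ?_)⟩
  rw [hfloor, div_le_iff₀' hs']
  exact hfl
end
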